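/- Let A be an integral domain that is a finitely generated algebra over the complex numbers ℂ. Then the quotient group Aˣ / ℂˣ of the group of units of A by the image of ℂˣ (under the map sending a nonzero scalar c to the unit c·1) is a free abelian group of finite rank. -/

import Mathlib

open IntermediateField

universe u

open scoped IntermediateField.algebraAdjoinAdjoin in
theorem isDedekindDomain_integralClosure_adjoin_singleton (F K : Type*) [Field F] [CharZero F]
    [Field K] [Algebra F K] (s : K) [FiniteDimensional F⟮s⟯ K] :
    IsDedekindDomain (integralClosure (Algebra.adjoin F {s}) K) ∧
      IsFractionRing (integralClosure (Algebra.adjoin F {s}) K) K := by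
  have : IsPrincipalIdealRing (Algebra.adjoin F {s}) := by
    have := Algebra.adjoin_singleton_eq_range_aeval F s
    rw [this]
    exact IsPrincipalIdealRing.of_surjective (Polynomial.aeval (R := F) s).rangeRestrict
      (Polynomial.aeval (R := F) s).rangeRestrict_surjective
  have : CharZero F⟮s⟯ := charZero_of_injective_algebraMap (algebraMap F F⟮s⟯).injective
  exact ⟨integralClosure.isDedekindDomain _ F⟮s⟯ K,
    IsIntegralClosure.isFractionRing_of_finite_extension (Algebra.adjoin F {s}) F⟮s⟯ K _⟩

/-- An element lying in every valuation subring that contains `F` is integral over `F`. -/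
theorem isIntegral_of_forall_mem_valuationSubring {F K : Type*} [Field F] [Field K] [Algebra F K]
    {x : K} (h : ∀ V : ValuationSubring K, (∀ a, algebraMap F K a ∈ V) → x ∈ V) :
    IsIntegral F x := by
  have h1 : x ∈ (⨅ V : {V : ValuationSubring K // Set.range (algebraMap F K) ⊆ V.toSubring},
      V.1.toSubring) := by
    rw [Subring.mem_iInf]
    rintro ⟨V, hV⟩
    exact h V fun a => hV ⟨a, rfl⟩
  rw [iInf_valuationSubring_superset] at h1
  have h2 : IsIntegral (Subring.closure (Set.range (algebraMap F K))) x := h1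
  rw [← RingHom.coe_range, Subring.closure_eq] at h2
  let e := RingEquiv.ofBijective (algebraMap F K).rangeRestrict
    ⟨(algebraMap F K).rangeRestrict.injective, (algebraMap F K).rangeRestrict_surjective⟩
  refine h2.map_of_comp_eq (e.symm : (algebraMap F K).range →+* F) (RingHom.id K) ?_
  ext y
  exact congrArg Subtype.val (e.apply_symm_apply y)

/-- If `K` is finite over `F(t)`, finitely many discrete valuations of `K` (the places where `t` has a
pole) detect which elements integral over `F[t]` are integral over `F`. -/
theorem exists_places {F K : Type*} [Field F] [CharZero F]
    [Field K] [Algebra F K] (t : K) (ht : t ≠ 0) [FiniteDimensional F⟮t⟯ K] :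
    ∃ (n : ℕ) (ψ : Kˣ →* (Fin n → Multiplicative ℤ)), ∀ u : Kˣ, ψ u = 1 →
      IsIntegral (Algebra.adjoin F {t}) (u : K) → IsIntegral F (u : K) := by
  set s := t⁻¹ with hs
  have hs0 : s ≠ 0 := inv_ne_zero ht
  have hst : F⟮s⟯ = F⟮t⟯ := by
    apply le_antisymm <;> rw [adjoin_simple_le_iff]
    · exact inv_mem (mem_adjoin_simple_self F t)
    · simpa [hs] using inv_mem (mem_adjoin_simple_self F s)
  have : FiniteDimensional F⟮s⟯ K := by rwa [hst]
  obtain ⟨_, _⟩ := isDedekindDomain_integralClosure_adjoin_singleton F K s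
  set R := integralClosure (Algebra.adjoin F {s}) K with hR
  let s' : R := algebraMap (Algebra.adjoin F {s}) R ⟨s, Algebra.self_mem_adjoin_singleton F s⟩
  have hs' : (s' : K) = s := rfl
  have hs'0 : Ideal.span {s'} ≠ 0 := by
    rw [Ideal.zero_eq_bot, Ne, Ideal.span_singleton_eq_bot]
    exact fun h => hs0 (by rw [← hs', h]; rfl)
  have hfin := Ideal.finite_factors hs'0
  set S := {v : IsDedekindDomain.HeightOneSpectrum R | v.asIdeal ∣ Ideal.span {s'}}
  have : Finite S := hfin
  obtain ⟨n, ⟨e⟩⟩ := Finite.exists_equiv_fin S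
  let ψ : Kˣ →* (Fin n → Multiplicative ℤ) := MonoidHom.pi fun i =>
    (WithZero.unitsWithZeroEquiv : _ ≃* Multiplicative ℤ).toMonoidHom.comp
      (Units.map ((e.symm i).1.valuation K).toMonoidWithZeroHom.toMonoidHom)
  refine ⟨n, ψ, fun u hu hinteg => isIntegral_of_forall_mem_valuationSubring fun V hV => ?_⟩
  have hadj : ∀ z ∈ V, ∀ x : K, IsIntegral (Algebra.adjoin F {z}) x → x ∈ V := by
    intro z hz x hx
    let W : Subalgebra F K := { V.toSubring with algebraMap_mem' := hV }
    have hW : Algebra.adjoin F {z} ≤ W :=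
      Algebra.adjoin_le (Set.singleton_subset_iff.mpr hz)
    let g : Algebra.adjoin F {z} →+* V := (Subalgebra.inclusion hW).toRingHom
    have hx' : IsIntegral V x := hx.map_of_comp_eq g (RingHom.id K) rfl
    obtain ⟨y, rfl⟩ := IsIntegrallyClosed.isIntegral_iff.mp hx'
    exact y.2
  by_cases htV : t ∈ V
  · exact hadj t htV u hinteg
  have hsV : s ∈ V := (V.mem_or_inv_mem t).resolve_left htV
  have hRV : ∀ x : R, (x : K) ∈ V := fun x => hadj s hsV x x.2
  let f : R →+* V := R.val.toRingHom.codRestrict V.toSubring hRV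
  let P : Ideal R := (IsLocalRing.maximalIdeal V).comap f
  have hsP : s' ∈ P := by
    rw [Ideal.mem_comap, IsLocalRing.mem_maximalIdeal, mem_nonunits_iff]
    intro hunit
    apply htV
    obtain ⟨y, hy⟩ := hunit.exists_right_inv
    have hy' : s * (y : K) = 1 := congrArg Subtype.val hy
    have : t = y := by rw [hs, inv_mul_eq_one₀ ht] at hy'; exact hy'
    exact this ▸ y.2
  let v : IsDedekindDomain.HeightOneSpectrum R :=
    ⟨P, Ideal.comap_isPrime _ _, fun h => hs'0 (by simpa [h] using hsP)⟩
  have hvS : v ∈ S := Ideal.dvd_span_singleton.mpr hsP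
  have hvu : v.valuation K (u : K) = 1 := by
    have h1 := congrFun hu (e ⟨v, hvS⟩)
    simp only [ψ, MonoidHom.pi_apply, MonoidHom.comp_apply, Equiv.symm_apply_apply,
      Pi.one_apply, MulEquiv.toMonoidHom_eq_coe, MonoidHom.coe_coe, map_eq_one_iff _ (MulEquiv.injective _)] at h1
    exact congrArg Units.val h1
  obtain ⟨a, d, had⟩ :=
    IsDedekindDomain.HeightOneSpectrum.exists_primeCompl_mul_eq_of_integer v _ hvu.le
  have hd : IsUnit (f d) := by
    by_contra h
    exact d.2 h
  obtain ⟨y, hy⟩ := hd.exists_right_inv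
  have hy' : ((d : R) : K) * (y : K) = 1 := congrArg Subtype.val hy
  have had' : (u : K) * ((d : R) : K) = (a : K) := had
  have : (u : K) = a * y := by rw [← had', mul_assoc, hy', mul_one]
  exact this ▸ V.mul_mem _ _ (hRV a) y.2

/-- If `A` is integral over `C[t]`, a unit of `A` in the kernel of a suitable homomorphism to `ℤⁿ` is
algebraic over `C`. -/
theorem exists_hom_isAlgebraic (C A : Type*) [CommRing C] [IsDomain C] [CharZero C] [CommRing A]
    [IsDomain A] [Algebra C A] [FaithfulSMul C A] [Algebra.FiniteType C A] (t : A) (ht : t ≠ 0)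
    (hinteg : ∀ a : A, IsIntegral (Algebra.adjoin C {t}) a) :
    ∃ (n : ℕ) (ψ : Aˣ →* (Fin n → Multiplicative ℤ)), ∀ u : Aˣ, ψ u = 1 →
      IsAlgebraic C (u : A) := by
  let F := FractionRing C
  let K := FractionRing A
  have hinj : Function.Injective (algebraMap A K) := IsFractionRing.injective A K
  have : FaithfulSMul C K := by
    rw [faithfulSMul_iff_algebraMap_injective, IsScalarTower.algebraMap_eq C A K]
    exact hinj.comp (FaithfulSMul.algebraMap_injective C A)
  let : Algebra F K := FractionRing.liftAlgebra C K
  have : IsScalarTower C F K := FractionRing.isScalarTower_liftAlgebra C K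
  have : CharZero F := charZero_of_injective_algebraMap (IsFractionRing.injective C F)
  set τ : K := algebraMap A K t
  have hτ : τ ≠ 0 := by simpa [τ] using ht
  have hintF : ∀ a : A, IsIntegral (Algebra.adjoin F {τ}) (algebraMap A K a) := by
    intro a
    let j : A →ₐ[C] K := IsScalarTower.toAlgHom C A K
    have hle : Algebra.adjoin C {t} ≤ ((Algebra.adjoin F {τ}).restrictScalars C).comap j :=
      Algebra.adjoin_le (Set.singleton_subset_iff.mpr (Algebra.self_mem_adjoin_singleton F τ))
    let g : Algebra.adjoin C {t} →+* Algebra.adjoin F {τ} :=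
      (j.toRingHom.comp (Algebra.adjoin C {t}).val.toRingHom).codRestrict
        (Algebra.adjoin F {τ}).toSubring fun x => hle x.2
    exact (hinteg a).map_of_comp_eq g (algebraMap A K) rfl
  have : Algebra.EssFiniteType F⟮τ⟯ K := by
    have : Algebra.EssFiniteType A K := .of_isLocalization _ (nonZeroDivisors A)
    have : Algebra.EssFiniteType C K := .comp C A K
    have : Algebra.EssFiniteType F K := .of_comp C F K
    exact .of_comp F F⟮τ⟯ K
  have : Algebra.IsIntegral F⟮τ⟯ K := by
    refine ⟨fun x => ?_⟩
    have hA : ∀ a : A, IsIntegral F⟮τ⟯ (algebraMap A K a) := fun a =>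
      (hintF a).map_of_comp_eq
        (Subalgebra.inclusion (algebra_adjoin_le_adjoin F {τ})).toRingHom (RingHom.id K) rfl
    obtain ⟨a, b, -, rfl⟩ := IsFractionRing.div_surjective A x
    rw [div_eq_mul_inv]
    exact (hA a).mul (hA b).inv
  have : FiniteDimensional F⟮τ⟯ K := by
    exact Algebra.finite_of_essFiniteType_of_isAlgebraic
  obtain ⟨n, ψ, hψ⟩ := exists_places (F := F) τ hτ
  refine ⟨n, ψ.comp (Units.map (algebraMap A K).toMonoidHom), fun u hu => ?_⟩
  have h1 : IsIntegral F (algebraMap A K u) := hψ _ hu (hintF u)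
  have h2 : IsAlgebraic C (algebraMap A K u) :=
    (IsFractionRing.isAlgebraic_iff C F K).mpr h1.isAlgebraic
  exact (isAlgebraic_algebraMap_iff hinj).mp h2

/-- The unit group of an algebraically closed field is divisible, so it has no nontrivial
homomorphism to a power of `ℤ`. -/
theorem monoidHom_units_eq_one {k ι : Type*} [Field k] [IsAlgClosed k]
    (φ : kˣ →* (ι → Multiplicative ℤ)) : φ = 1 := by
  ext x i
  obtain ⟨y, hy⟩ := IsAlgClosed.exists_pow_nat_eq (x : k)
    (Nat.succ_pos (Multiplicative.toAdd (φ x i)).natAbs)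
  have hy0 : y ≠ 0 := by
    rintro rfl
    exact x.ne_zero (by rw [← hy, zero_pow (Nat.succ_ne_zero _)])
  have hx : Units.mk0 y hy0 ^ ((Multiplicative.toAdd (φ x i)).natAbs + 1) = x := Units.ext hy
  have hdvd : (((Multiplicative.toAdd (φ x i)).natAbs + 1 : ℕ) : ℤ) ∣
      Multiplicative.toAdd (φ x i) := by
    refine ⟨Multiplicative.toAdd (φ (Units.mk0 y hy0) i), ?_⟩
    conv_lhs => rw [← hx]
    rw [map_pow, Pi.pow_apply, toAdd_pow, nsmul_eq_mul]
  have := Int.eq_zero_of_dvd_of_natAbs_lt_natAbs hdvd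
    (by rw [Int.natAbs_natCast]; exact Nat.lt_succ_self _)
  exact Multiplicative.toAdd.injective this

/-- By induction on the number of variables in a Noether normalization of `A`: some homomorphism from
`Aˣ` to a power of `ℤ` has only scalars in its kernel. -/
theorem exists_hom_ker_le_scalars (d : ℕ) : ∀ (A : Type u) [CommRing A] [IsDomain A] [Algebra ℂ A]
    [Algebra.FiniteType ℂ A] (g : MvPolynomial (Fin d) ℂ →ₐ[ℂ] A),
    Function.Injective g → g.toRingHom.IsIntegral →
    ∃ (n : ℕ) (ψ : Aˣ →* (Fin n → Multiplicative ℤ)),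
      ∀ u : Aˣ, ψ u = 1 → ∃ c : ℂ, algebraMap ℂ A c = u := by
  induction d with
  | zero =>
    intro A _ _ _ _ g _ hg
    refine ⟨0, 1, fun u _ => ?_⟩
    have : Algebra.IsIntegral ℂ A := by
      rw [← algebraMap_isIntegral_iff]
      have : algebraMap ℂ A = g.toRingHom.comp (algebraMap ℂ _) := g.comp_algebraMap.symm
      rw [this]
      refine RingHom.IsIntegral.trans _ _ (RingHom.isIntegral_of_surjective _ ?_) hg
      exact MvPolynomial.C_surjective (Fin 0)
    exact IsAlgClosed.algebraMap_bijective_of_isIntegral.surjective (u : A)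
  | succ d ih =>
    intro A _ _ _ _ g hg hgi
    let C := MvPolynomial (Fin d) ℂ
    let h : Polynomial C →ₐ[ℂ] A :=
      g.comp (MvPolynomial.finSuccEquiv ℂ d).symm.toAlgHom
    have hinj : Function.Injective h := hg.comp (MvPolynomial.finSuccEquiv ℂ d).symm.injective
    have hhi : h.toRingHom.IsIntegral :=
      RingHom.IsIntegral.trans (MvPolynomial.finSuccEquiv ℂ d).symm.toAlgHom.toRingHom g.toRingHom
        (RingHom.isIntegral_of_surjective _ (MvPolynomial.finSuccEquiv ℂ d).symm.surjective) hgi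
    let : Algebra (Polynomial C) A := h.toRingHom.toAlgebra
    have : Algebra.IsIntegral (Polynomial C) A := algebraMap_isIntegral_iff.mp hhi
    have hprime : (Ideal.span {(Polynomial.X : Polynomial C)}).IsPrime :=
      (Ideal.span_singleton_prime Polynomial.X_ne_zero).mpr Polynomial.prime_X
    obtain ⟨Q, hQ, hQX⟩ := Ideal.exists_ideal_over_prime_of_isIntegral_of_isDomain (S := A)
      (Ideal.span {(Polynomial.X : Polynomial C)})
      (((RingHom.injective_iff_ker_eq_bot _).mp hinj).le.trans bot_le)
    let k : C →ₐ[ℂ] A := h.comp (Polynomial.CAlgHom (R := ℂ) (A := C))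
    have hkinj : Function.Injective k := hinj.comp Polynomial.C_injective
    let : Algebra C A := k.toRingHom.toAlgebra
    have : IsScalarTower ℂ C A := .of_algHom k
    have hQ0 : Q.comap (algebraMap C A) = ⊥ := by
      rw [eq_bot_iff]
      intro c hc
      have : Polynomial.C c ∈ Q.comap (algebraMap (Polynomial C) A) := hc
      rw [hQX, Ideal.mem_span_singleton, Polynomial.X_dvd_iff, Polynomial.coeff_C_zero] at this
      exact this
    let gB : C →ₐ[ℂ] A ⧸ Q := (Ideal.Quotient.mkₐ ℂ Q).comp k
    have hgB : Function.Injective gB := by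
      rw [injective_iff_map_eq_zero]
      intro c hc
      have : c ∈ Q.comap (algebraMap C A) := (Ideal.Quotient.eq_zero_iff_mem (I := Q)).mp hc
      rwa [hQ0] at this
    have hgBi : gB.toRingHom.IsIntegral := by
      have h1 : ((Ideal.Quotient.mk Q).comp h.toRingHom).IsIntegral :=
        RingHom.IsIntegral.trans _ _ hhi
          (RingHom.isIntegral_of_surjective _ Ideal.Quotient.mk_surjective)
      have h2 : (Ideal.Quotient.mk Q).comp h.toRingHom =
          gB.toRingHom.comp (Polynomial.constantCoeff (R := C)) := by
        apply Polynomial.ringHom_ext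
        · intro c
          simp [gB, k]
        · have : (Polynomial.X : Polynomial C) ∈ Q.comap (algebraMap (Polynomial C) A) := by
            rw [hQX]; exact Ideal.mem_span_singleton_self _
          have : Ideal.Quotient.mk Q (h Polynomial.X) = 0 := Ideal.Quotient.eq_zero_iff_mem.mpr this
          simpa using this
      rw [h2] at h1
      exact RingHom.IsIntegral.tower_top _ _ h1
    obtain ⟨n, ψ, hψ⟩ := ih (A ⧸ Q) gB hgB hgBi
    have : FaithfulSMul C A := (faithfulSMul_iff_algebraMap_injective C A).mpr hkinj
    have : Algebra.FiniteType C A := .of_restrictScalars_finiteType ℂ C A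
    obtain ⟨m, χ, hχ⟩ := exists_hom_isAlgebraic C A (h Polynomial.X)
      (by rw [Ne, map_eq_zero_iff _ hinj]; exact Polynomial.X_ne_zero) (by
        intro a
        have hmem : ∀ p, h p ∈ Algebra.adjoin C {h Polynomial.X} := by
          intro p
          induction p using Polynomial.induction_on' with
          | add p q hp hq => rw [map_add]; exact add_mem hp hq
          | monomial i c =>
            rw [← Polynomial.C_mul_X_pow_eq_monomial, map_mul, map_pow]
            exact mul_mem (Subalgebra.algebraMap_mem _ c)
              (pow_mem (Algebra.self_mem_adjoin_singleton C _) i)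
        have ha : IsIntegral (Polynomial C) a := hhi a
        exact ha.map_of_comp_eq (h.toRingHom.codRestrict _ hmem) (RingHom.id A) rfl)
    let Ψ : Aˣ →* (Fin n → Multiplicative ℤ) :=
      ψ.comp (Units.map (Ideal.Quotient.mk Q).toMonoidHom)
    refine ⟨n + m, MonoidHom.pi (Fin.addCases (fun i => (Pi.evalMonoidHom _ i).comp Ψ)
      (fun i => (Pi.evalMonoidHom _ i).comp χ)), fun u hu => ?_⟩
    have hΨu : Ψ u = 1 := by
      ext i
      simpa using congrFun hu (Fin.castAdd m i)
    have hχu : χ u = 1 := by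
      ext i
      simpa using congrFun hu (Fin.natAdd n i)
    obtain ⟨c, hc⟩ := hψ _ hΨu
    have hc' : Ideal.Quotient.mk Q (algebraMap ℂ A c) = Ideal.Quotient.mk Q (u : A) := hc
    have hc0 : c ≠ 0 := by
      rintro rfl
      have : IsUnit (Ideal.Quotient.mk Q (u : A)) := u.isUnit.map _
      rw [← hc', map_zero, map_zero] at this
      exact not_isUnit_zero this
    let z : Aˣ := Units.map (algebraMap ℂ A).toMonoidHom (Units.mk0 c hc0)
    have hz : χ z = 1 := DFunLike.congr_fun
      (monoidHom_units_eq_one (χ.comp (Units.map (algebraMap ℂ A).toMonoidHom))) (Units.mk0 c hc0)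
    have halg : IsAlgebraic C ((u * z⁻¹ : Aˣ) : A) := hχ _ (by rw [map_mul, map_inv, hχu, hz]; simp)
    have hmem : ((u * z⁻¹ : Aˣ) : A) - 1 ∈ Q := by
      have hzu : (u : A) - z ∈ Q := (Ideal.Quotient.mk_eq_mk_iff_sub_mem _ _).mp hc'.symm
      have := Q.mul_mem_right ((z⁻¹ : Aˣ) : A) hzu
      rwa [sub_mul, Units.mul_inv, ← Units.val_mul] at this
    have hone : ((u * z⁻¹ : Aˣ) : A) - 1 = 0 := by
      by_contra hne
      exact Ideal.comap_ne_bot_of_algebraic_mem hne hmem (halg.sub isAlgebraic_one) hQ0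
    have huz : u = z := mul_inv_eq_one.mp (Units.ext (sub_eq_zero.mp hone))
    exact ⟨c, by rw [huz]; rfl⟩

/-- A subgroup of `ℤⁿ` is free of finite rank. -/
theorem exists_mulEquiv_of_injective {G : Type*} [CommGroup G] {n : ℕ}
    (φ : G →* (Fin n → Multiplicative ℤ)) (hφ : Function.Injective φ) :
    ∃ m : ℕ, Nonempty (G ≃* Multiplicative (Fin m → ℤ)) := by
  let f : Additive G →ₗ[ℤ] (Fin n → ℤ) := AddMonoidHom.toIntLinearMap <|
    MonoidHom.toAdditiveLeft
      ((MulEquiv.piMultiplicative fun _ : Fin n => ℤ).symm.toMonoidHom.comp φ)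
  have hf : Function.Injective f :=
    (MulEquiv.piMultiplicative fun _ : Fin n => ℤ).symm.injective.comp hφ
  have : Module.Finite ℤ (Additive G) := Module.Finite.of_injective f hf
  have : Module.IsTorsionFree ℤ (Additive G) := hf.moduleIsTorsionFree f (map_smul f)
  let b := Module.finBasis ℤ (Additive G)
  exact ⟨_, ⟨AddEquiv.toMultiplicativeRight b.equivFun.toAddEquiv⟩⟩

/-- For an integral domain `A` that is a finitely generated `ℂ`-algebra, the
quotient of the unit group `Aˣ` by the image of `ℂˣ` (via `c ↦ c • 1`) is a
free abelian group of finite rank. -/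
theorem units_quotient_scalars_free_of_finite_rank
    (A : Type*) [CommRing A] [IsDomain A] [Algebra ℂ A] [Algebra.FiniteType ℂ A] :
    ∃ n : ℕ, Nonempty
      ((Aˣ ⧸ (Units.map (algebraMap ℂ A).toMonoidHom).range) ≃*
        Multiplicative (Fin n → ℤ)) := by
  obtain ⟨d, g, hg, hgi⟩ := exists_integral_inj_algHom_of_fg ℂ A
  obtain ⟨n, ψ, hψ⟩ := exists_hom_ker_le_scalars d A g hg hgi
  set H := (Units.map (algebraMap ℂ A).toMonoidHom).range with hH
  have hker : ψ.ker = H := by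
    ext u
    constructor
    · intro hu
      obtain ⟨c, hc⟩ := hψ u hu
      have hc0 : c ≠ 0 := by
        rintro rfl
        exact u.ne_zero (by rw [← hc, map_zero])
      exact ⟨Units.mk0 c hc0, Units.ext hc⟩
    · rintro ⟨c, rfl⟩
      exact DFunLike.congr_fun
        (monoidHom_units_eq_one (ψ.comp (Units.map (algebraMap ℂ A).toMonoidHom))) c
  obtain ⟨m, ⟨e⟩⟩ := exists_mulEquiv_of_injective (G := Aˣ ⧸ ψ.ker) (QuotientGroup.kerLift ψ)
    (QuotientGroup.kerLift_injective ψ)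
  exact ⟨m, ⟨(QuotientGroup.quotientMulEquivOfEq hker).symm.trans e⟩⟩
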